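/- Let F be a finite field, ξ a nonzero element of F, and Γ ∈ F[X] a monic irreducible polynomial with Γ ≠ X such that Γ does not divide X² − ξ and such that the set of roots of Γ in an algebraic closure of F is stable under the map α ↦ ξ·α⁻¹. Then the degree of Γ is even. -/

import Mathlib

/-- Let `F` be a finite field, `ξ` a nonzero element of `F`, and `Γ ∈ F[X]` a monic irreducible
polynomial with `Γ ≠ X`, such that `Γ` does not divide `X² − ξ` and the set of roots of `Γ` in an
algebraic closure of `F` is stable under `α ↦ ξ·α⁻¹`.  Then the degree of `Γ` is even. -/
theorem degree_even_of_selfdual {F : Type*} [Field F] [Fintype F] (ξ : F) (hξ : ξ ≠ 0)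
    (Γ : Polynomial F) (hmonic : Γ.Monic) (hirr : Irreducible Γ) (hX : Γ ≠ Polynomial.X)
    (hdvd : ¬ Γ ∣ (Polynomial.X ^ 2 - Polynomial.C ξ))
    (hstab : ∀ α : AlgebraicClosure F, Polynomial.aeval α Γ = 0 →
      Polynomial.aeval (algebraMap F (AlgebraicClosure F) ξ * α⁻¹) Γ = 0) :
    Even Γ.natDegree := by
  classical
  have hmin : ∀ α : AlgebraicClosure F, Polynomial.aeval α Γ = 0 → Γ = minpoly F α :=
    fun α h => minpoly.eq_of_irreducible_of_monic hirr h hmonic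
  have hne : ∀ α : AlgebraicClosure F, Polynomial.aeval α Γ = 0 → α ≠ 0 := by
    intro α h h0
    apply hX
    rw [hmin α h, h0, minpoly.zero]
  have hfix : ∀ α : AlgebraicClosure F, Polynomial.aeval α Γ = 0 →
      algebraMap F (AlgebraicClosure F) ξ * α⁻¹ ≠ α := by
    intro α h he
    apply hdvd
    rw [hmin α h]
    apply minpoly.dvd
    have h0 := hne α h
    have h2 : algebraMap F (AlgebraicClosure F) ξ = α ^ 2 := by
      field_simp at he
      exact he
    simp [h2]
  have hξ' : algebraMap F (AlgebraicClosure F) ξ ≠ 0 := by simpa using hξ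
  have hcard : Fintype.card (Γ.rootSet (AlgebraicClosure F)) = Γ.natDegree :=
    Polynomial.card_rootSet_eq_natDegree (PerfectField.separable_of_irreducible hirr)
      (IsAlgClosed.splits _)
  have hmem : ∀ α : AlgebraicClosure F, α ∈ (Γ.rootSet (AlgebraicClosure F)).toFinset ↔
      Polynomial.aeval α Γ = 0 := by
    intro α
    rw [Set.mem_toFinset, Polynomial.mem_rootSet]
    simp [hmonic.ne_zero]
  have hsum : ∑ _α ∈ (Γ.rootSet (AlgebraicClosure F)).toFinset, (1 : ZMod 2) = 0 := by
    refine Finset.sum_involution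
      (fun α _ => algebraMap F (AlgebraicClosure F) ξ * α⁻¹) ?_ ?_ ?_ ?_
    · intro α h
      decide
    · intro α h _
      exact hfix α ((hmem α).1 h)
    · intro α h
      exact (hmem _).2 (hstab α ((hmem α).1 h))
    · intro α h
      have h0 := hne α ((hmem α).1 h)
      field_simp
  rw [← hcard, ← Set.toFinset_card, ← ZMod.natCast_eq_zero_iff_even]
  simpa using hsum
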